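/- arXiv:1209.3746 — 14 statements merged into one kernel-verified Lean document; each statement's English description precedes it below -/
import Mathlib

section
/- Let V be a nonzero complex vector space equipped with linear maps T, P : V → V satisfying P∘T − T∘P = T, such that T is injective and the only subspaces of V invariant under both T and P are 0 and V. Then T is bijective (so the irreducible torsion-free module over the algebra generated by t and ∂ extends to a module over ℂ[t,t⁻¹,∂]). -/
/-- If `V` is a nonzero complex vector space with linear maps `T, P`
satisfying `P∘T − T∘P = T`, `T` injective, and the only subspaces invariant under
both `T` and `P` are `0` and `V`, then `T` is bijective. -/
theorem stmt0 (V : Type*) [AddCommGroup V] [Module ℂ V] [Nontrivial V]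
    (T P : V →ₗ[ℂ] V)
    (hcomm : P ∘ₗ T - T ∘ₗ P = T)
    (hTinj : Function.Injective T)
    (hirr : ∀ W : Submodule ℂ V, (∀ v ∈ W, T v ∈ W) → (∀ v ∈ W, P v ∈ W) →
      W = ⊥ ∨ W = ⊤) :
    Function.Bijective T := by
  refine ⟨hTinj, ?_⟩
  rcases hirr (LinearMap.range T) (fun v _ => ⟨v, rfl⟩) (by
    rintro _ ⟨v, rfl⟩
    refine ⟨P v + v, ?_⟩
    have h := LinearMap.congr_fun hcomm v
    simp only [LinearMap.sub_apply, LinearMap.comp_apply] at h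
    rw [map_add, sub_eq_iff_eq_add.mp h, add_comm]) with h | h
  · exfalso
    obtain ⟨v, hv⟩ := exists_ne (0 : V)
    apply hv
    apply hTinj
    rw [LinearMap.range_eq_bot.mp h]
    simp
  · exact LinearMap.range_eq_top.mp h
end

section
/- Let V be a complex vector space with a bijective linear map T : V → V and a linear map P : V → V satisfying P∘T − T∘P = T. Fix b ∈ ℂ and for each n ∈ ℤ set D_n := T^n∘P + n·b·T^n (where T^n for n < 0 means the (−n)-th power of T⁻¹). Then for all m, n ∈ ℤ: (1) D_m∘D_n − D_n∘D_m = (n−m)·D_{m+n}, and (2) D_n∘T^m − T^m∘D_n = m·T^{m+n}. In particular the operators D_n define a representation of the centerless Virasoro (Witt) algebra on V, and together with the T^m a representation of the twisted Heisenberg–Virasoro algebra with trivial central action. -/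
/-- The operator by which the Virasoro generator `d_n` acts on the twisted module
`A_b`: `D_n = T^n ∘ P + n·b·T^n`, where `T` is the (bijective) action of `t` and
`P` the action of `∂` on a `𝒦`-module. -/
noncomputable def Dop {V : Type*} [AddCommGroup V] [Module ℂ V]
    (T : V ≃ₗ[ℂ] V) (P : V →ₗ[ℂ] V) (b : ℂ) (n : ℤ) : V →ₗ[ℂ] V :=
  ((T ^ n : V ≃ₗ[ℂ] V) : V →ₗ[ℂ] V) ∘ₗ P + ((n : ℂ) * b) • ((T ^ n : V ≃ₗ[ℂ] V) : V →ₗ[ℂ] V)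

/-- the operators `D_n = T^n∘P + n·b·T^n` satisfy the centerless
Virasoro relations `[D_m, D_n] = (n−m)·D_{m+n}` and, together with the `T^m`,
the twisted Heisenberg–Virasoro relations `[D_n, T^m] = m·T^{m+n}` (with trivial
central action). -/
theorem stmt1 (V : Type*) [AddCommGroup V] [Module ℂ V]
    (T : V ≃ₗ[ℂ] V) (P : V →ₗ[ℂ] V)
    (hcomm : P ∘ₗ (T : V →ₗ[ℂ] V) - (T : V →ₗ[ℂ] V) ∘ₗ P = (T : V →ₗ[ℂ] V))
    (b : ℂ) :
    (∀ m n : ℤ, Dop T P b m ∘ₗ Dop T P b n - Dop T P b n ∘ₗ Dop T P b m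
      = ((n : ℂ) - (m : ℂ)) • Dop T P b (m + n)) ∧
    (∀ m n : ℤ, Dop T P b n ∘ₗ ((T ^ m : V ≃ₗ[ℂ] V) : V →ₗ[ℂ] V)
      - ((T ^ m : V ≃ₗ[ℂ] V) : V →ₗ[ℂ] V) ∘ₗ Dop T P b n
      = (m : ℂ) • ((T ^ (m + n) : V ≃ₗ[ℂ] V) : V →ₗ[ℂ] V)) := by
  have h1 : ∀ v, P (T v) = T (P v) + T v := by
    intro v
    have := LinearMap.congr_fun hcomm v
    simp only [LinearMap.sub_apply, LinearMap.comp_apply, LinearEquiv.coe_coe] at this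
    rw [← sub_eq_iff_eq_add']
    exact this
  have hadd : ∀ (m n : ℤ) (v : V), (T ^ m) ((T ^ n) v) = (T ^ (m + n)) v := by
    intro m n v
    rw [zpow_add]; rfl
  have hs : ∀ (n : ℤ) (v : V), (T ^ (n + 1)) v = T ((T ^ n) v) := by
    intro n v
    rw [add_comm, zpow_add, zpow_one]; rfl
  have key : ∀ (n : ℤ) (v : V), P ((T ^ n) v) = (T ^ n) (P v) + (n : ℂ) • (T ^ n) v := by
    intro n
    induction n using Int.induction_on with
    | zero => intro v; simp
    | succ k ih =>
      intro v
      rw [hs, h1, ih, hs]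
      simp only [map_add, map_smul]
      push_cast
      module
    | pred k ih =>
      intro v
      apply T.injective
      have e : ∀ w, T ((T ^ (-(k : ℤ) - 1)) w) = (T ^ (-(k : ℤ))) w := by
        intro w
        rw [← hs, sub_add_cancel]
      have h2 := h1 ((T ^ (-(k : ℤ) - 1)) v)
      rw [e, ih] at h2
      rw [← sub_eq_iff_eq_add] at h2
      rw [← h2]
      simp only [map_add, map_smul, e]
      push_cast
      module
  constructor
  · intro m n
    ext v
    simp only [Dop, LinearMap.sub_apply, LinearMap.comp_apply, LinearMap.add_apply,
      LinearMap.smul_apply, LinearEquiv.coe_coe, map_add, map_smul, key, hadd, add_comm n m]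
    push_cast
    module
  · intro m n
    ext v
    simp only [Dop, LinearMap.sub_apply, LinearMap.comp_apply, LinearMap.add_apply,
      LinearMap.smul_apply, LinearEquiv.coe_coe, map_add, map_smul, key, hadd, add_comm n m]
    module
end

section
/- Let V be a complex vector space with a bijective linear map T : V → V and a linear map P : V → V satisfying P∘T − T∘P = T. Fix b ∈ ℂ and set D_n := T^n∘P + n·b·T^n for n ∈ ℤ. Then for every k ∈ ℤ, the operator w_k := −(1/2)·D_{k−1}∘D_1 − (1/2)·D_{k+1}∘D_{−1} + D_k∘D_0 equals b(b−1)·T^k; that is, w_k v = b(b−1)·T^k v for all v ∈ V. -/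
/-- for every `k ∈ ℤ`, the operator
`w_k = −(1/2)·D_{k−1}∘D_1 − (1/2)·D_{k+1}∘D_{−1} + D_k∘D_0`
equals `b(b−1)·T^k`, i.e. `w_k v = b(b−1)·T^k v` for all `v ∈ V`. -/
theorem stmt2 (V : Type*) [AddCommGroup V] [Module ℂ V]
    (T : V ≃ₗ[ℂ] V) (P : V →ₗ[ℂ] V)
    (hcomm : P ∘ₗ (T : V →ₗ[ℂ] V) - (T : V →ₗ[ℂ] V) ∘ₗ P = (T : V →ₗ[ℂ] V))
    (b : ℂ) :
    ∀ (k : ℤ) (v : V),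
      (-(1/2 : ℂ)) • (Dop T P b (k - 1)) (Dop T P b 1 v)
      + (-(1/2 : ℂ)) • (Dop T P b (k + 1)) (Dop T P b (-1) v)
      + (Dop T P b k) (Dop T P b 0 v)
      = (b * (b - 1)) • (T ^ k : V ≃ₗ[ℂ] V) v := by
  intro k v
  have h1 : ∀ x, P (T x) = T (P x) + T x := by
    intro x
    have h := LinearMap.congr_fun hcomm x
    simp only [LinearMap.sub_apply, LinearMap.comp_apply, LinearEquiv.coe_coe] at h
    rw [sub_eq_iff_eq_add] at h
    rw [h, add_comm]
  have e1 : ∀ x, (T ^ (1 : ℤ) : V ≃ₗ[ℂ] V) x = T x := by intro x; rw [zpow_one]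
  have e0 : ∀ x, (T ^ (0 : ℤ) : V ≃ₗ[ℂ] V) x = x := by intro x; rw [zpow_zero]; rfl
  have hT : ∀ x, T ((T ^ (-1 : ℤ) : V ≃ₗ[ℂ] V) x) = x := by
    intro x
    rw [← e1, ← LinearEquiv.mul_apply, ← zpow_add]
    exact e0 x
  have h2 : ∀ x, P ((T ^ (-1 : ℤ) : V ≃ₗ[ℂ] V) x)
      = (T ^ (-1 : ℤ) : V ≃ₗ[ℂ] V) (P x) - (T ^ (-1 : ℤ) : V ≃ₗ[ℂ] V) x := by
    intro x
    apply T.injective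
    have h := h1 ((T ^ (-1 : ℤ) : V ≃ₗ[ℂ] V) x)
    rw [hT] at h
    rw [map_sub, hT, hT, h]
    abel
  have a1 : ∀ x, (T ^ (k - 1) : V ≃ₗ[ℂ] V) (T x) = (T ^ k : V ≃ₗ[ℂ] V) x := by
    intro x
    rw [← e1 x, ← LinearEquiv.mul_apply, ← zpow_add, sub_add_cancel]
  have a2 : ∀ x, (T ^ (k + 1) : V ≃ₗ[ℂ] V) ((T ^ (-1 : ℤ) : V ≃ₗ[ℂ] V) x)
      = (T ^ k : V ≃ₗ[ℂ] V) x := by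
    intro x
    rw [← LinearEquiv.mul_apply, ← zpow_add, add_neg_cancel_right]
  simp only [Dop, LinearMap.add_apply, LinearMap.comp_apply, LinearMap.smul_apply,
    LinearEquiv.coe_coe, map_add, map_sub, map_smul, e1, e0, h1, h2, a1, a2]
  push_cast
  module
end

section
/- Let V be a complex vector space with a bijective linear map T : V → V and a linear map P : V → V satisfying P∘T − T∘P = T, and suppose the only subspaces of V invariant under T, T⁻¹ and P are 0 and V (i.e. V is an irreducible 𝒦-module). If b ∈ ℂ with b ≠ 0 and b ≠ 1, then the only subspaces of V invariant under all the operators D_n := T^n∘P + n·b·T^n (n ∈ ℤ) are 0 and V; that is, the twisted Virasoro module A_b is irreducible. -/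
/-- if `(V, T, P)` is an irreducible `𝒦`-module and `b ≠ 0, 1`,
then the twisted Virasoro module `A_b` (with `d_n` acting by
`D_n = T^n∘P + n·b·T^n`) is irreducible. -/
theorem stmt3 (V : Type*) [AddCommGroup V] [Module ℂ V]
    (T : V ≃ₗ[ℂ] V) (P : V →ₗ[ℂ] V)
    (hcomm : P ∘ₗ (T : V →ₗ[ℂ] V) - (T : V →ₗ[ℂ] V) ∘ₗ P = (T : V →ₗ[ℂ] V))
    (hirr : ∀ W : Submodule ℂ V, (∀ v ∈ W, T v ∈ W) → (∀ v ∈ W, T.symm v ∈ W) →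
      (∀ v ∈ W, P v ∈ W) → W = ⊥ ∨ W = ⊤)
    (b : ℂ) (hb0 : b ≠ 0) (hb1 : b ≠ 1) :
    ∀ W : Submodule ℂ V, (∀ (n : ℤ), ∀ v ∈ W, Dop T P b n v ∈ W) →
      W = ⊥ ∨ W = ⊤ := by
  intro W hW
  have hPT : ∀ v, P (T v) = T (P v) + T v := by
    intro v
    have h := LinearMap.congr_fun hcomm v
    simp only [LinearMap.sub_apply, LinearMap.comp_apply, LinearEquiv.coe_coe] at h
    rw [← sub_eq_iff_eq_add']; exact h
  have hPS : ∀ v, P (T.symm v) = T.symm (P v) - T.symm v := by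
    intro v
    have h := hPT (T.symm v)
    apply T.injective
    rw [T.apply_symm_apply] at h
    rw [map_sub, T.apply_symm_apply, T.apply_symm_apply, h]
    abel
  have e0 : ∀ v, Dop T P b 0 v = P v := by intro v; simp [Dop]
  have e1 : ∀ v, Dop T P b 1 v = T (P v) + b • T v := by intro v; simp [Dop]
  have e2 : ∀ v, Dop T P b 2 v = T (T (P v)) + (2 * b) • T (T v) := by
    intro v
    have h : (T ^ (2 : ℤ)) = T * T := by rw [zpow_ofNat, pow_two]
    simp [Dop, h]
  have hi : T⁻¹ = T.symm := rfl
  have e1' : ∀ v, Dop T P b (-1) v = T.symm (P v) - b • T.symm v := by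
    intro v
    have h : (T ^ (-1 : ℤ)) = T.symm := by rw [zpow_neg_one, hi]
    simp only [Dop, h]
    simp [sub_eq_add_neg]
  have e2' : ∀ v, Dop T P b (-2) v = T.symm (T.symm (P v)) - (2 * b) • T.symm (T.symm v) := by
    intro v
    have h : (T ^ (-2 : ℤ)) = T.symm * T.symm := by
      rw [zpow_neg, zpow_ofNat, pow_two, mul_inv_rev, hi]
    simp only [Dop, h]
    simp [sub_eq_add_neg]
  have hc : 2 * b * (1 - b) ≠ 0 :=
    mul_ne_zero (mul_ne_zero two_ne_zero hb0) (sub_ne_zero.mpr hb1.symm)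
  refine hirr W (fun v hv => ?_) (fun v hv => ?_) (fun v hv => by simpa [e0] using hW 0 v hv)
  · rw [← W.smul_mem_iff hc]
    have h := W.sub_mem (W.add_mem (hW 0 _ (hW 1 v hv)) (hW 2 _ (hW (-1) v hv)))
      (W.smul_mem (2 : ℂ) (hW 1 _ (hW 0 v hv)))
    convert h using 1
    simp only [e0, e1, e2, e1', map_add, map_sub, map_smul, hPT, hPS, T.apply_symm_apply]
    module
  · rw [← W.smul_mem_iff hc]
    have h := W.sub_mem (W.add_mem (hW (-2) _ (hW 1 v hv)) (hW 0 _ (hW (-1) v hv)))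
      (W.smul_mem (2 : ℂ) (hW (-1) _ (hW 0 v hv)))
    convert h using 1
    simp only [e0, e1, e2', e1', map_add, map_sub, map_smul, hPT, hPS, T.symm_apply_apply]
    module
end

section
/- Let V be a complex vector space with a bijective linear map T : V → V and a linear map P : V → V satisfying P∘T − T∘P = T, and suppose the only subspaces of V invariant under T, T⁻¹ and P are 0 and V (i.e. V is an irreducible 𝒦-module). Then the only subspaces of V invariant under all the operators D_n := T^n∘P (n ∈ ℤ) are 0 and V if and only if V is not isomorphic to the natural 𝒦-module ℂ[t,t⁻¹], i.e. if and only if there is no linear equivalence φ : V ≃ ℂ[t,t⁻¹] satisfying φ∘T = M_t∘φ and φ∘P = E∘φ, where M_t is multiplication by t and E is the linear map with E(t^n) = n·t^n. -/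
/-- Multiplication by `t` on the natural `𝒦`-module `ℂ[t,t⁻¹]`, realized on
`ℤ →₀ ℂ` (with `Finsupp.single n c` standing for `c·tⁿ`): `tⁿ ↦ tⁿ⁺¹`. -/
noncomputable def laurentShift : (ℤ →₀ ℂ) →ₗ[ℂ] (ℤ →₀ ℂ) :=
  Finsupp.lsum ℂ fun n => Finsupp.lsingle (n + 1)

/-- The action of `∂ = t·d/dt` on the natural `𝒦`-module `ℂ[t,t⁻¹]`, realized on
`ℤ →₀ ℂ`: the linear map `E` with `E(tⁿ) = n·tⁿ`. -/
noncomputable def laurentDeg : (ℤ →₀ ℂ) →ₗ[ℂ] (ℤ →₀ ℂ) :=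
  Finsupp.lsum ℂ fun n => (n : ℂ) • Finsupp.lsingle n

/-- for an irreducible `𝒦`-module `(V, T, P)`, the twisted Virasoro
module `A_0` (with `d_n` acting by `D_n = T^n∘P`) is irreducible iff `V` is not
isomorphic to the natural `𝒦`-module `ℂ[t,t⁻¹]`. -/
theorem stmt4 (V : Type*) [AddCommGroup V] [Module ℂ V]
    (T : V ≃ₗ[ℂ] V) (P : V →ₗ[ℂ] V)
    (hcomm : P ∘ₗ (T : V →ₗ[ℂ] V) - (T : V →ₗ[ℂ] V) ∘ₗ P = (T : V →ₗ[ℂ] V))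
    (hirr : ∀ W : Submodule ℂ V, (∀ v ∈ W, T v ∈ W) → (∀ v ∈ W, T.symm v ∈ W) →
      (∀ v ∈ W, P v ∈ W) → W = ⊥ ∨ W = ⊤) :
    (∀ W : Submodule ℂ V,
        (∀ (n : ℤ), ∀ v ∈ W, (((T ^ n : V ≃ₗ[ℂ] V) : V →ₗ[ℂ] V) ∘ₗ P) v ∈ W) →
        W = ⊥ ∨ W = ⊤)
    ↔ ¬ ∃ φ : V ≃ₗ[ℂ] (ℤ →₀ ℂ),
        (∀ v, φ (T v) = laurentShift (φ v)) ∧ (∀ v, φ (P v) = laurentDeg (φ v)) := by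
  have hc : ∀ v, P (T v) = T (P v) + T v := by
    intro v
    have := LinearMap.congr_fun hcomm v
    simp only [LinearMap.sub_apply, LinearMap.comp_apply, LinearEquiv.coe_coe] at this
    rw [← sub_eq_iff_eq_add']
    exact this
  have hs : ∀ (n : ℤ) v, (T ^ (n + 1)) v = T ((T ^ n) v) := by
    intro n v
    rw [add_comm, zpow_add, zpow_one, LinearEquiv.mul_apply]
  constructor
  · rintro h ⟨φ, -, h2⟩
    set w := φ.symm (Finsupp.single 0 1) with hw
    have hφw : φ w = Finsupp.single 0 1 := by simp [hw]
    have hPw : P w = 0 := by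
      apply φ.injective
      rw [h2, hφw]
      simp [laurentDeg]
    rcases h (Submodule.span ℂ {w}) (by
      intro n v hv
      obtain ⟨c, rfl⟩ := Submodule.mem_span_singleton.1 hv
      simp [hPw]) with h | h
    · rw [Submodule.span_singleton_eq_bot] at h
      rw [h, map_zero] at hφw
      have := DFunLike.congr_fun hφw 0
      simp at this
    · have : φ.symm (Finsupp.single 1 1) ∈ Submodule.span ℂ {w} := by rw [h]; trivial
      obtain ⟨c, hc⟩ := Submodule.mem_span_singleton.1 this
      have h3 := congrArg φ hc
      rw [map_smul, hφw, LinearEquiv.apply_symm_apply] at h3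
      have := DFunLike.congr_fun h3 1
      simp at this
  · intro hno W hW
    by_contra hcon
    push Not at hcon
    obtain ⟨hbot, htop⟩ := hcon
    have hPW : ∀ w ∈ W, P w = 0 := by
      let U : Submodule ℂ V :=
        { carrier := {v | ∀ k : ℤ, (T ^ k) v ∈ W}
          zero_mem' := by intro k; simp
          add_mem' := by
            intro a b ha hb k
            rw [map_add]
            exact W.add_mem (ha k) (hb k)
          smul_mem' := by
            intro c a ha k
            rw [map_smul]
            exact W.smul_mem c (ha k) }
      have hUW : ∀ v ∈ U, v ∈ W := fun v hv => by simpa using hv 0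
      have hPU : ∀ v ∈ W, P v ∈ U := fun v hv k => hW k v hv
      rcases hirr U (by
          intro v hv k
          have := hv (k + 1)
          rwa [zpow_add, zpow_one, LinearEquiv.mul_apply] at this)
        (by
          intro v hv k
          have := hv (k - 1)
          rwa [zpow_sub, zpow_one, LinearEquiv.mul_apply] at this)
        (fun v hv => hPU v (hUW v hv)) with h | h
      · intro w hw
        have := hPU w hw
        rwa [h, Submodule.mem_bot] at this
      · exact absurd (eq_top_iff.2 fun v _ => hUW v (by rw [h]; trivial)) htop
    obtain ⟨w, hwW, hw0⟩ := W.ne_bot_iff.1 hbot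
    have hPw := hPW w hwW
    have hs' : ∀ (n : ℤ), T.symm ((T ^ n) w) = (T ^ (n - 1)) w := by
      intro n
      rw [LinearEquiv.symm_apply_eq, ← hs, sub_add_cancel]
    have hPn : ∀ n : ℤ, P ((T ^ n) w) = (n : ℂ) • (T ^ n) w := by
      intro n
      induction n using Int.induction_on with
      | zero => simp [hPw]
      | succ n ih =>
        rw [hs, hc, ih, map_smul]
        push_cast
        module
      | pred n ih =>
        apply T.injective
        have e : T ((T ^ (-(n : ℤ) - 1)) w) = (T ^ (-(n : ℤ))) w := by
          rw [← hs, sub_add_cancel]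
        have := hc ((T ^ (-(n : ℤ) - 1)) w)
        rw [e, ih] at this
        rw [map_smul, e, ← sub_eq_iff_eq_add.2 this]
        push_cast
        module
    let ψ : (ℤ →₀ ℂ) →ₗ[ℂ] V := Finsupp.linearCombination ℂ (fun n : ℤ => (T ^ n) w)
    have hψ1 : ∀ f, ψ (laurentShift f) = T (ψ f) := by
      intro f
      induction f using Finsupp.induction_linear with
      | zero => simp
      | add f g hf hg => simp only [map_add, hf, hg]
      | single n c => simp [ψ, laurentShift, hs]
    have hψ2 : ∀ f, ψ (laurentDeg f) = P (ψ f) := by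
      intro f
      induction f using Finsupp.induction_linear with
      | zero => simp
      | add f g hf hg => simp only [map_add, hf, hg]
      | single n c =>
        have e : laurentDeg (Finsupp.single n c) = (n : ℂ) • Finsupp.single n c := by
          simp [laurentDeg]
        rw [e, map_smul]
        simp only [ψ, Finsupp.linearCombination_single, map_smul, hPn]
        rw [smul_comm]
    have hψ3 : ∀ f, ∃ g, ψ g = T.symm (ψ f) := by
      intro f
      induction f using Finsupp.induction_linear with
      | zero => exact ⟨0, by simp⟩
      | add f g hf hg =>
        obtain ⟨a, ha⟩ := hf
        obtain ⟨b, hb⟩ := hg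
        exact ⟨a + b, by simp only [map_add, ha, hb]⟩
      | single n c => exact ⟨Finsupp.single (n - 1) c, by simp [ψ, hs']⟩
    have hinj : Function.Injective ψ := by
      have : LinearIndependent ℂ (fun n : ℤ => (T ^ n) w) := by
        refine Module.End.eigenvectors_linearIndependent' P (fun n : ℤ => (n : ℂ))
          Int.cast_injective _ fun n => ?_
        refine ⟨Module.End.mem_eigenspace_iff.2 (hPn n), ?_⟩
        simpa using hw0
      exact this
    have hsurj : Function.Surjective ψ := by
      rw [← LinearMap.range_eq_top]
      refine (hirr (LinearMap.range ψ) ?_ ?_ ?_).resolve_left ?_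
      · rintro _ ⟨f, rfl⟩
        exact ⟨_, hψ1 f⟩
      · rintro _ ⟨f, rfl⟩
        exact hψ3 f
      · rintro _ ⟨f, rfl⟩
        exact ⟨_, hψ2 f⟩
      · intro h
        have : w ∈ LinearMap.range ψ := ⟨Finsupp.single 0 1, by simp [ψ]⟩
        rw [h] at this
        exact hw0 this
    let e := LinearEquiv.ofBijective ψ ⟨hinj, hsurj⟩
    have he : ∀ v, ψ (e.symm v) = v := fun v => e.apply_symm_apply v
    refine hno ⟨e.symm, fun v => hinj ?_, fun v => hinj ?_⟩
    · rw [he, hψ1, he]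
    · rw [he, hψ2, he]
end

section
/- On the Laurent polynomial space ℂ[t,t⁻¹] over ℂ, define for each k ∈ ℤ the linear operator D_k by D_k(t^n) = n·t^{k+n} for all n ∈ ℤ. Then every subspace W of ℂ[t,t⁻¹] that contains the constants ℂ·1 and is invariant under all D_k (k ∈ ℤ) equals either ℂ·1 or all of ℂ[t,t⁻¹]; equivalently, the quotient ℂ[t,t⁻¹]/ℂ is an irreducible module for the operators induced by the D_k. -/
/-- The action of the Virasoro generator `d_k` (with `b = 0`) on the natural
`𝒦`-module `ℂ[t,t⁻¹]`, realized on `ℤ →₀ ℂ` (with `Finsupp.single n c` standing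
for `c·tⁿ`): `D_k(tⁿ) = n·t^{k+n}`. -/
noncomputable def Dnat (k : ℤ) : (ℤ →₀ ℂ) →ₗ[ℂ] (ℤ →₀ ℂ) :=
  Finsupp.lsum ℂ fun n => (n : ℂ) • Finsupp.lsingle (k + n)

theorem Dnat_single (k n : ℤ) (c : ℂ) :
    Dnat k (Finsupp.single n c) = Finsupp.single (k + n) ((n : ℂ) * c) := by
  simp [Dnat]

theorem Dnat_zero_apply (f : ℤ →₀ ℂ) (n : ℤ) : Dnat 0 f n = (n : ℂ) * f n := by
  induction f using Finsupp.induction_linear with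
  | zero => simp
  | add f g hf hg => simp [hf, hg, mul_add]
  | single m c =>
    rw [Dnat_single, zero_add]
    by_cases h : m = n
    · subst h; simp
    · simp [Finsupp.single_apply, h]

theorem single_mem_of_mem (W : Submodule ℂ (ℤ →₀ ℂ))
    (hD : ∀ (k : ℤ), ∀ f ∈ W, Dnat k f ∈ W) (n : ℤ) :
    ∀ (N : ℕ) (f : ℤ →₀ ℂ), f.support.card ≤ N → f ∈ W → f n ≠ 0 →
      Finsupp.single n (1 : ℂ) ∈ W := by
  intro N
  induction N with
  | zero =>
    intro f hc _ hn
    have : f = 0 := by simpa using hc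
    simp [this] at hn
  | succ N ih =>
    intro f hc hf hn
    by_cases h : ∃ m, m ≠ n ∧ f m ≠ 0
    · obtain ⟨m, hmn, hm⟩ := h
      have key : ∀ j, (Dnat 0 f - (m : ℂ) • f) j = ((j : ℂ) - m) * f j := by
        intro j
        simp [Dnat_zero_apply, sub_mul]
      refine ih (Dnat 0 f - (m : ℂ) • f) ?_ (W.sub_mem (hD 0 f hf) (W.smul_mem _ hf)) ?_
      · have hsub : (Dnat 0 f - (m : ℂ) • f).support ⊆ f.support.erase m := by
          intro j hj
          rw [Finsupp.mem_support_iff, key] at hj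
          rw [Finset.mem_erase, Finsupp.mem_support_iff]
          refine ⟨?_, right_ne_zero_of_mul hj⟩
          rintro rfl
          simp at hj
        have h1 := Finset.card_le_card hsub
        have h2 := Finset.card_erase_lt_of_mem (Finsupp.mem_support_iff.2 hm)
        omega
      · rw [key]
        refine mul_ne_zero (sub_ne_zero.2 ?_) hn
        exact_mod_cast hmn.symm
    · push Not at h
      have : Finsupp.single n (1 : ℂ) = (f n)⁻¹ • f := by
        ext j
        by_cases hj : j = n
        · subst hj; simp [hn]
        · simp [h j hj, Finsupp.single_apply, Ne.symm hj]
      rw [this]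
      exact W.smul_mem _ hf

/-- every subspace of `ℂ[t,t⁻¹]` containing the constants and
invariant under all `D_k` is either `ℂ·1` or everything; equivalently the
quotient `ℂ[t,t⁻¹]/ℂ` is irreducible under the induced operators. -/
theorem stmt5 :
    ∀ W : Submodule ℂ (ℤ →₀ ℂ),
      Finsupp.single (0 : ℤ) (1 : ℂ) ∈ W →
      (∀ (k : ℤ), ∀ f ∈ W, Dnat k f ∈ W) →
      W = Submodule.span ℂ {Finsupp.single (0 : ℤ) (1 : ℂ)} ∨ W = ⊤ := by
  intro W h0 hD
  by_cases h : ∃ f ∈ W, ∃ n : ℤ, n ≠ 0 ∧ f n ≠ 0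
  · right
    obtain ⟨f, hf, n, hn0, hn⟩ := h
    have h1 := single_mem_of_mem W hD n _ f le_rfl hf hn
    have hn0' : (n : ℂ) ≠ 0 := by exact_mod_cast hn0
    rw [eq_top_iff]
    rintro g -
    induction g using Finsupp.induction_linear with
    | zero => exact W.zero_mem
    | add f g hf hg => exact W.add_mem hf hg
    | single m c =>
      have h2 := W.smul_mem (c * (n : ℂ)⁻¹) (hD (m - n) _ h1)
      rw [Dnat_single] at h2
      simpa [hn0'] using h2
  · left
    push Not at h
    apply le_antisymm
    · intro f hf
      rw [Submodule.mem_span_singleton]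
      refine ⟨f 0, ?_⟩
      ext j
      by_cases hj : j = 0
      · subst hj; simp
      · simp [h f hf j hj, Finsupp.single_apply, Ne.symm hj]
    · rw [Submodule.span_le]
      simpa using h0
end

section
/- Let V be a complex vector space with a bijective linear map T : V → V and a linear map P : V → V satisfying P∘T − T∘P = T, such that the only subspaces of V invariant under T, T⁻¹ and P are 0 and V (i.e. V is an irreducible 𝒦-module). Let b ∈ ℂ and D_n := T^n∘P + n·b·T^n for n ∈ ℤ. Then the only subspaces of V invariant under all D_n (n ∈ ℤ) are 0 and V if and only if one of the following holds: (i) b ≠ 0 and b ≠ 1; (ii) b = 1 and P(V) = V; (iii) b = 0 and V is not isomorphic to the natural 𝒦-module ℂ[t,t⁻¹] (no linear equivalence φ : V ≃ ℂ[t,t⁻¹] with φ∘T = M_t∘φ and φ∘P = E∘φ, where M_t is multiplication by t and E(t^n) = n·t^n). -/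
theorem comm_aux {V : Type*} [AddCommGroup V] [Module ℂ V]
    (T : V ≃ₗ[ℂ] V) (P : V →ₗ[ℂ] V)
    (hcomm : P ∘ₗ (T : V →ₗ[ℂ] V) - (T : V →ₗ[ℂ] V) ∘ₗ P = (T : V →ₗ[ℂ] V))
    (n : ℤ) (v : V) : P ((T ^ n) v) = (T ^ n) (P v) + (n : ℂ) • (T ^ n) v := by
  have h1 : ∀ v, P (T v) = T (P v) + T v := fun v => by
    have := LinearMap.congr_fun hcomm v
    simp only [LinearMap.sub_apply, LinearMap.comp_apply, LinearEquiv.coe_coe] at this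
    rw [sub_eq_iff_eq_add] at this
    rw [this, add_comm]
  have hs : ∀ v, P (T⁻¹ v) = T⁻¹ (P v) - T⁻¹ v := fun v => by
    apply T.injective
    have h2 := h1 (T⁻¹ v)
    have h3 : ∀ u, T (T⁻¹ u) = u := fun u => T.apply_symm_apply u
    rw [h3] at h2
    rw [map_sub, h3, h3, h2]
    abel
  induction n using Int.induction_on generalizing v with
  | zero => simp
  | succ k ih =>
    rw [zpow_add, zpow_one, LinearEquiv.mul_apply, ih, h1, map_add]
    simp only [LinearEquiv.mul_apply]
    push_cast
    module
  | pred k ih =>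
    rw [zpow_sub, zpow_one, LinearEquiv.mul_apply, ih, hs, map_sub]
    simp only [LinearEquiv.mul_apply]
    push_cast
    module

theorem dop_apply {V : Type*} [AddCommGroup V] [Module ℂ V]
    (T : V ≃ₗ[ℂ] V) (P : V →ₗ[ℂ] V) (b : ℂ) (n : ℤ) (v : V) :
    Dop T P b n v = (T ^ n) (P v) + ((n : ℂ) * b) • (T ^ n) v := by
  simp [Dop]

/-- Theorem 9 of the paper: for an irreducible `𝒦`-module
`(V, T, P)` and `b ∈ ℂ`, the twisted Virasoro module `A_b` is irreducible iff
(i) `b ≠ 0, 1`; or (ii) `b = 1` and `P(V) = V`; or (iii) `b = 0` and `V` is not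
isomorphic to the natural `𝒦`-module `ℂ[t,t⁻¹]`. -/
theorem stmt7 (V : Type*) [AddCommGroup V] [Module ℂ V]
    (T : V ≃ₗ[ℂ] V) (P : V →ₗ[ℂ] V)
    (hcomm : P ∘ₗ (T : V →ₗ[ℂ] V) - (T : V →ₗ[ℂ] V) ∘ₗ P = (T : V →ₗ[ℂ] V))
    (hirr : ∀ W : Submodule ℂ V, (∀ v ∈ W, T v ∈ W) → (∀ v ∈ W, T.symm v ∈ W) →
      (∀ v ∈ W, P v ∈ W) → W = ⊥ ∨ W = ⊤)
    (b : ℂ) :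
    (∀ W : Submodule ℂ V, (∀ (n : ℤ), ∀ v ∈ W, Dop T P b n v ∈ W) →
        W = ⊥ ∨ W = ⊤)
    ↔ ((b ≠ 0 ∧ b ≠ 1)
      ∨ (b = 1 ∧ LinearMap.range P = ⊤)
      ∨ (b = 0 ∧ ¬ ∃ φ : V ≃ₗ[ℂ] (ℤ →₀ ℂ),
          (∀ v, φ (T v) = laurentShift (φ v)) ∧
          (∀ v, φ (P v) = laurentDeg (φ v)))) := by
  have hc := comm_aux T P hcomm
  have hadd : ∀ (m n : ℤ) v, (T ^ m) ((T ^ n) v) = (T ^ (m + n)) v := fun m n v => by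
    rw [zpow_add, LinearEquiv.mul_apply]
  have h1 : ∀ v, T v = (T ^ (1 : ℤ)) v := fun v => by rw [zpow_one]
  have hm1 : ∀ v, T.symm v = (T ^ (-1 : ℤ)) v := fun v => by rw [zpow_neg_one]; rfl
  have h0 : ∀ v, (T ^ (0 : ℤ)) v = v := fun v => by simp
  have hirr' : ∀ W : Submodule ℂ V, (∀ (n : ℤ), ∀ v ∈ W, (T ^ n) v ∈ W) →
      (∀ v ∈ W, P v ∈ W) → W = ⊥ ∨ W = ⊤ := fun W hT hP =>
    hirr W (fun v hv => by rw [h1]; exact hT _ _ hv)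
      (fun v hv => by rw [hm1]; exact hT _ _ hv) hP
  have hD : ∀ n v, Dop T P b n v = (T ^ n) (P v) + ((n : ℂ) * b) • (T ^ n) v :=
    dop_apply T P b
  have hDP : ∀ W : Submodule ℂ V, (∀ (n : ℤ), ∀ v ∈ W, Dop T P b n v ∈ W) →
      ∀ v ∈ W, P v ∈ W := fun W hW v hv => by
    have := hW 0 v hv
    rw [hD, h0] at this
    simpa using this
  by_cases hb0 : b = 0
  · subst hb0
    have hD0 : ∀ n v, Dop T P 0 n v = (T ^ n) (P v) := fun n v => by rw [hD]; simp
    have key : (∀ W : Submodule ℂ V, (∀ (n : ℤ), ∀ v ∈ W, Dop T P 0 n v ∈ W) →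
        W = ⊥ ∨ W = ⊤) ↔ ¬ ∃ φ : V ≃ₗ[ℂ] (ℤ →₀ ℂ),
          (∀ v, φ (T v) = laurentShift (φ v)) ∧
          (∀ v, φ (P v) = laurentDeg (φ v)) := by
      constructor
      · rintro h ⟨φ, hφT, hφP⟩
        have hdeg : ∀ n : ℤ, laurentDeg (Finsupp.single n 1) = Finsupp.single n (n : ℂ) := by
          intro n; simp [laurentDeg]
        rcases h (LinearMap.ker P) (fun n v hv => by
          rw [LinearMap.mem_ker] at hv
          rw [hD0, hv, map_zero]; exact zero_mem _) with hk | hk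
        · have : φ.symm (Finsupp.single 0 1) ∈ LinearMap.ker P := by
            rw [LinearMap.mem_ker]
            apply φ.injective
            rw [hφP, φ.apply_symm_apply, hdeg]; simp
          rw [hk, Submodule.mem_bot] at this
          simp at this
        · have : φ.symm (Finsupp.single 1 1) ∈ LinearMap.ker P := by
            rw [hk]; trivial
          rw [LinearMap.mem_ker] at this
          have h2 := hφP (φ.symm (Finsupp.single 1 1))
          rw [this, φ.apply_symm_apply, hdeg] at h2
          have h3 := DFunLike.congr_fun h2 1
          simp at h3
      · intro hn W hW
        have hP := hDP W hW
        by_cases hker : ∀ w ∈ W, P w = 0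
        · left
          rw [Submodule.eq_bot_iff]
          intro w hw
          by_contra hw0
          apply hn
          have hPw := hker w hw
          have hPT : ∀ n : ℤ, P ((T ^ n) w) = (n : ℂ) • (T ^ n) w := fun n => by
            rw [hc, hPw, map_zero, zero_add]
          have hne : ∀ n : ℤ, (T ^ n) w ≠ 0 := fun n h =>
            hw0 ((T ^ n).map_eq_zero_iff.mp h)
          have hli : LinearIndependent ℂ (fun n : ℤ => (T ^ n) w) := by
            refine Module.End.eigenvectors_linearIndependent' P (fun n : ℤ => (n : ℂ))
              Int.cast_injective _ (fun n => ?_)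
            rw [Module.End.hasEigenvector_iff, Module.End.mem_eigenspace_iff]
            exact ⟨hPT n, hne n⟩
          have hspan : Submodule.span ℂ (Set.range (fun n : ℤ => (T ^ n) w)) = ⊤ := by
            have hTT : ∀ (n : ℤ), ∀ v ∈ (Submodule.span ℂ (Set.range (fun n : ℤ => (T ^ n) w))), (T ^ n) v ∈ (Submodule.span ℂ (Set.range (fun n : ℤ => (T ^ n) w))) := by
              intro n v hv
              induction hv using Submodule.span_induction with
              | mem x hx =>
                obtain ⟨m, rfl⟩ := hx
                exact Submodule.subset_span ⟨n + m, (hadd n m w).symm⟩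
              | zero => simp
              | add x y _ _ hx hy => rw [map_add]; exact add_mem hx hy
              | smul a x _ hx => rw [map_smul]; exact Submodule.smul_mem _ _ hx
            have hPP : ∀ v ∈ (Submodule.span ℂ (Set.range (fun n : ℤ => (T ^ n) w))), P v ∈ (Submodule.span ℂ (Set.range (fun n : ℤ => (T ^ n) w))) := by
              intro v hv
              induction hv using Submodule.span_induction with
              | mem x hx =>
                obtain ⟨m, rfl⟩ := hx
                simp only [hPT]
                exact Submodule.smul_mem _ _ (Submodule.subset_span ⟨m, rfl⟩)
              | zero => simp
              | add x y _ _ hx hy => rw [map_add]; exact add_mem hx hy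
              | smul a x _ hx => rw [map_smul]; exact Submodule.smul_mem _ _ hx
            rcases hirr' (Submodule.span ℂ (Set.range (fun n : ℤ => (T ^ n) w))) hTT hPP with h | h
            · exfalso
              have : (T ^ (0 : ℤ)) w ∈ Submodule.span ℂ (Set.range (fun n : ℤ => (T ^ n) w)) :=
                Submodule.subset_span ⟨0, rfl⟩
              rw [h, Submodule.mem_bot] at this
              exact hne 0 this
            · exact h
          let B := Module.Basis.mk hli hspan.ge
          have hB : ∀ n, B n = (T ^ n) w := fun n => by simp [B]
          refine ⟨B.repr, fun v => ?_, fun v => ?_⟩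
          · have : B.repr.toLinearMap ∘ₗ T.toLinearMap = laurentShift ∘ₗ B.repr.toLinearMap := by
              refine B.ext fun n => ?_
              have : T (B n) = B (n + 1) := by
                rw [hB, hB, h1, hadd, add_comm]
              simp [this, laurentShift]
            exact LinearMap.congr_fun this v
          · have : B.repr.toLinearMap ∘ₗ P = laurentDeg ∘ₗ B.repr.toLinearMap := by
              refine B.ext fun n => ?_
              have : P (B n) = (n : ℂ) • B n := by
                rw [hB, hPT]
              simp [this, laurentDeg]
            exact LinearMap.congr_fun this v
        · right
          push Not at hker
          obtain ⟨w, hw, hPw⟩ := hker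
          let S : Set V := {x | ∃ n : ℤ, ∃ u ∈ W, x = (T ^ n) (P u)}
          have hSW : Submodule.span ℂ S ≤ W := by
            rw [Submodule.span_le]
            rintro _ ⟨n, u, hu, rfl⟩
            have := hW n u hu
            rwa [hD0] at this
          have hTT : ∀ (n : ℤ), ∀ v ∈ (Submodule.span ℂ S), (T ^ n) v ∈ (Submodule.span ℂ S) := by
            intro n v hv
            induction hv using Submodule.span_induction with
            | mem x hx =>
              obtain ⟨m, u, hu, rfl⟩ := hx
              exact Submodule.subset_span ⟨n + m, u, hu, hadd n m _⟩
            | zero => simp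
            | add x y _ _ hx hy => rw [map_add]; exact add_mem hx hy
            | smul a x _ hx => rw [map_smul]; exact Submodule.smul_mem _ _ hx
          have hPP : ∀ v ∈ (Submodule.span ℂ S), P v ∈ (Submodule.span ℂ S) := by
            intro v hv
            induction hv using Submodule.span_induction with
            | mem x hx =>
              obtain ⟨m, u, hu, rfl⟩ := hx
              rw [hc]
              exact add_mem (Submodule.subset_span ⟨m, P u, hP u hu, rfl⟩)
                (Submodule.smul_mem _ _ (Submodule.subset_span ⟨m, u, hu, rfl⟩))
            | zero => simp
            | add x y _ _ hx hy => rw [map_add]; exact add_mem hx hy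
            | smul a x _ hx => rw [map_smul]; exact Submodule.smul_mem _ _ hx
          rcases hirr' (Submodule.span ℂ S) hTT hPP with h | h
          · exfalso
            have : P w ∈ Submodule.span ℂ S := Submodule.subset_span ⟨0, w, hw, (h0 _).symm⟩
            rw [h, Submodule.mem_bot] at this
            exact hPw this
          · rw [h] at hSW
            exact top_le_iff.mp hSW
    rw [key]
    simp
  by_cases hb1 : b = 1
  · subst hb1
    have hD1 : ∀ n v, Dop T P 1 n v = P ((T ^ n) v) := fun n v => by rw [hD, hc, mul_one]
    have key : (∀ W : Submodule ℂ V, (∀ (n : ℤ), ∀ v ∈ W, Dop T P 1 n v ∈ W) →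
        W = ⊥ ∨ W = ⊤) ↔ LinearMap.range P = ⊤ := by
      constructor
      · intro h
        rcases h (LinearMap.range P) (fun n v _ => by rw [hD1]; exact ⟨_, rfl⟩) with hk | hk
        · have hP0 : P = 0 := LinearMap.range_eq_bot.mp hk
          rw [eq_top_iff]
          intro v _
          have := hc 1 (T.symm v)
          rw [← h1] at this
          simp [hP0] at this
          rw [← this]; exact zero_mem _
        · exact hk
      · intro hr W hW
        have hP := hDP W hW
        have hW' : ∀ (n : ℤ), ∀ v ∈ W, P ((T ^ n) v) ∈ W := fun n v hv => by
          rw [← hD1]; exact hW n v hv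
        let U : Submodule ℂ V :=
          { carrier := {v | ∀ n : ℤ, P ((T ^ n) v) ∈ W}
            zero_mem' := fun n => by simp
            add_mem' := fun {x y} hx hy n => by
              rw [map_add, map_add]; exact add_mem (hx n) (hy n)
            smul_mem' := fun a x hx n => by
              rw [map_smul, map_smul]; exact Submodule.smul_mem _ _ (hx n) }
        have hWU : W ≤ U := fun v hv n => hW' n v hv
        have hTT : ∀ (n : ℤ), ∀ v ∈ U, (T ^ n) v ∈ U := by
          intro n v hv m
          rw [hadd]; exact hv _
        have hPP : ∀ v ∈ U, P v ∈ U := by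
          intro v hv n
          have : (T ^ n) (P v) = P ((T ^ n) v) - (n : ℂ) • (T ^ n) v := by
            rw [hc]; abel
          rw [this, map_sub, map_smul]
          exact sub_mem (hP _ (hv n)) (Submodule.smul_mem _ _ (hv n))
        rcases hirr' U hTT hPP with h | h
        · left; rw [h] at hWU; exact le_bot_iff.mp hWU
        · right
          rw [eq_top_iff, ← hr]
          rintro _ ⟨v, rfl⟩
          have hv : v ∈ U := by rw [h]; trivial
          have := hv 0
          rwa [h0] at this
    rw [key]
    simp
  · refine iff_of_true ?_ (Or.inl ⟨hb0, hb1⟩)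
    intro W hW
    refine hirr' W (fun m v hv => ?_) (hDP W hW)
    have hk : ∀ k : ℤ, Dop T P b (m - k) (Dop T P b k v) ∈ W := fun k => hW _ _ (hW _ _ hv)
    have hexp : ∀ k : ℤ, Dop T P b (m - k) (Dop T P b k v) =
        (T ^ m) (P (P v)) + ((k : ℂ) + m * b) • (T ^ m) (P v)
          + ((k : ℂ) ^ 2 * (b - b ^ 2) + m * k * b ^ 2) • (T ^ m) v := fun k => by
      have e : m - k + k = m := by ring
      rw [hD, hD]
      simp only [map_add, map_smul, hc, hadd, e]
      push_cast
      module
    have hmem : (2 * (b - b ^ 2)) • (T ^ m) v ∈ W := by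
      have h2 := add_mem (sub_mem (hk 1) (hk 0)) (sub_mem (hk (-1)) (hk 0))
      rw [hexp, hexp, hexp] at h2
      convert h2 using 1
      push_cast
      module
    have hne : 2 * (b - b ^ 2) ≠ 0 := by
      have : 2 * (b - b ^ 2) = 2 * (b * (1 - b)) := by ring
      rw [this]
      exact mul_ne_zero two_ne_zero (mul_ne_zero hb0 (sub_ne_zero.mpr (Ne.symm hb1)))
    exact (Submodule.smul_mem_iff W hne).mp hmem
end

section
/- Let (V, T, P) and (W, S, Q) be irreducible 𝒦-modules. If there exists a linear bijection φ : V → W satisfying φ∘(T^n∘P) = (S^n∘Q)∘φ for all n ∈ ℤ (i.e. the Virasoro modules A_0 and B_0 are isomorphic), then V and W are isomorphic as 𝒦-modules, i.e. there exists a linear bijection ψ : V → W with ψ∘T = S∘ψ and ψ∘P = Q∘ψ. -/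
/-- Lemma 11 of the paper: if `(V,T,P)` and `(W,S,Q)` are
irreducible `𝒦`-modules and the twisted Virasoro modules `A_0` and `B_0`
(with `d_n` acting by `T^n∘P` resp. `S^n∘Q`) are isomorphic, then `V` and `W`
are isomorphic as `𝒦`-modules. -/
theorem stmt9 (V W : Type*) [AddCommGroup V] [Module ℂ V]
    [AddCommGroup W] [Module ℂ W]
    (T : V ≃ₗ[ℂ] V) (P : V →ₗ[ℂ] V)
    (hcommV : P ∘ₗ (T : V →ₗ[ℂ] V) - (T : V →ₗ[ℂ] V) ∘ₗ P = (T : V →ₗ[ℂ] V))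
    (hirrV : ∀ U : Submodule ℂ V, (∀ v ∈ U, T v ∈ U) → (∀ v ∈ U, T.symm v ∈ U) →
      (∀ v ∈ U, P v ∈ U) → U = ⊥ ∨ U = ⊤)
    (S : W ≃ₗ[ℂ] W) (Q : W →ₗ[ℂ] W)
    (hcommW : Q ∘ₗ (S : W →ₗ[ℂ] W) - (S : W →ₗ[ℂ] W) ∘ₗ Q = (S : W →ₗ[ℂ] W))
    (hirrW : ∀ U : Submodule ℂ W, (∀ w ∈ U, S w ∈ U) → (∀ w ∈ U, S.symm w ∈ U) →
      (∀ w ∈ U, Q w ∈ U) → U = ⊥ ∨ U = ⊤)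
    (φ : V ≃ₗ[ℂ] W)
    (hφ : ∀ (n : ℤ) (v : V),
      φ ((((T ^ n : V ≃ₗ[ℂ] V) : V →ₗ[ℂ] V) ∘ₗ P) v)
        = (((S ^ n : W ≃ₗ[ℂ] W) : W →ₗ[ℂ] W) ∘ₗ Q) (φ v)) :
    ∃ ψ : V ≃ₗ[ℂ] W, (∀ v, ψ (T v) = S (ψ v)) ∧ (∀ v, ψ (P v) = Q (ψ v)) := by
  have h0 : ∀ v, φ (P v) = Q (φ v) := fun v => by simpa using hφ 0 v
  have hP : ∀ (n : ℤ) (v : V), φ ((T ^ n) (P v)) = (S ^ n) (φ (P v)) := fun n v => by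
    rw [h0]; exact hφ n v
  let U : Submodule ℂ V :=
    { carrier := {u | ∀ n : ℤ, φ ((T ^ n) u) = (S ^ n) (φ u)}
      add_mem' := fun {a b} ha hb n => by
        simp only [map_add]; rw [ha n, hb n]
      zero_mem' := fun n => by simp
      smul_mem' := fun c a ha n => by
        simp only [map_smul]; rw [ha n] }
  have hz : ∀ (m : ℤ) (u : V), u ∈ U → (T ^ m) u ∈ U := by
    intro m u hu n
    rw [← LinearEquiv.mul_apply, ← zpow_add, hu (n + m), hu m, zpow_add, LinearEquiv.mul_apply]
  have hPU : ∀ v, P v ∈ U := fun v n => hP n v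
  have hU : ∀ v, v ∈ U := by
    rcases hirrV U (fun v hv => by simpa using hz 1 v hv)
      (fun v hv => by
        have := hz (-1) v hv
        rw [zpow_neg_one] at this
        exact this) (fun v _ => hPU v) with h | h
    · have hP0 : ∀ v, P v = 0 := fun v => by
        have := hPU v
        rwa [h, Submodule.mem_bot] at this
      intro v
      have h1 := LinearMap.congr_fun hcommV v
      simp only [LinearMap.sub_apply, LinearMap.comp_apply, hP0, map_zero, sub_zero,
        LinearEquiv.coe_coe] at h1
      have : v = 0 := by
        apply T.injective
        rw [← h1, map_zero]
      rw [this]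
      exact U.zero_mem
    · intro v
      rw [h]
      trivial
  exact ⟨φ, fun v => by simpa using hU v 1, h0⟩
end

section
/- Fix λ ∈ ℂ with λ ≠ 0. On the polynomial space ℂ[x] define the linear maps T by (T f)(x) = λ·f(x−1) and P by (P f)(x) = x·f(x). Then T is bijective, P∘T − T∘P = T, and the only subspaces of ℂ[x] invariant under T, T⁻¹ and P are 0 and ℂ[x]; that is, Ω(λ) := (ℂ[x], T, P) is an irreducible 𝒦-module. -/
open Polynomial

/-- The action of `t` on the `𝒦`-module `Ω(λ)`: on `ℂ[x]`, `(T f)(x) = λ·f(x−1)`. -/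
noncomputable def Tlam (l : ℂ) : Polynomial ℂ →ₗ[ℂ] Polynomial ℂ :=
  l • (Polynomial.aeval (Polynomial.X - Polynomial.C 1) :
    Polynomial ℂ →ₐ[ℂ] Polynomial ℂ).toLinearMap

/-- The action of `∂` on the `𝒦`-module `Ω(λ)`: multiplication by `x`. -/
noncomputable def Pmul : Polynomial ℂ →ₗ[ℂ] Polynomial ℂ :=
  LinearMap.mulLeft ℂ Polynomial.X

lemma Tlam_app (l : ℂ) (f : Polynomial ℂ) :
    Tlam l f = C l * f.comp (X - C 1) := by
  simp [Tlam, Polynomial.comp, Polynomial.aeval_def, Polynomial.smul_eq_C_mul, eval₂_eq_sum]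

lemma const_of_periodic (f : Polynomial ℂ) (h : f.comp (X - C 1) = f) :
    f = C (f.eval 0) := by
  have h1 : ∀ n : ℕ, f.eval (-(n : ℂ)) = f.eval 0 := by
    intro n
    induction n with
    | zero => simp
    | succ k ih =>
      rw [← ih]
      conv_rhs => rw [← h]
      simp only [eval_comp, eval_sub, eval_X, eval_C]
      congr 1
      push_cast
      ring
  apply Polynomial.eq_of_infinite_eval_eq
  have hinj : Function.Injective (fun n : ℕ => -(n : ℂ)) := by
    intro a b hab
    simpa using hab
  refine (Set.infinite_range_of_injective hinj).mono ?_
  rintro _ ⟨n, rfl⟩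
  simp [h1 n]

/-- for `λ ≠ 0`, the maps `T : f(x) ↦ λ·f(x−1)` and
`P : f ↦ x·f` on `ℂ[x]` satisfy: `T` is bijective, `P∘T − T∘P = T`, and the
only subspaces invariant under `T`, `T⁻¹` and `P` are `0` and `ℂ[x]`;
i.e. `Ω(λ)` is an irreducible `𝒦`-module. -/
theorem stmt11 (l : ℂ) (hl : l ≠ 0) :
    Function.Bijective (Tlam l)
    ∧ Pmul ∘ₗ Tlam l - Tlam l ∘ₗ Pmul = Tlam l
    ∧ ∀ W : Submodule ℂ (Polynomial ℂ),
        (∀ f ∈ W, Tlam l f ∈ W) →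
        (∀ f, Tlam l f ∈ W → f ∈ W) →
        (∀ f ∈ W, Pmul f ∈ W) →
        W = ⊥ ∨ W = ⊤ := by
  have hCl : (C l⁻¹ : ℂ[X]) * C l = 1 := by rw [← C_mul, inv_mul_cancel₀ hl, C_1]
  have hCl' : (C l : ℂ[X]) * C l⁻¹ = 1 := by rw [mul_comm, hCl]
  refine ⟨?_, ?_, ?_⟩
  · rw [Function.bijective_iff_has_inverse]
    refine ⟨fun g => C l⁻¹ * g.comp (X + C 1), ?_, ?_⟩
    · intro f
      simp only [Tlam_app, mul_comp, C_comp, comp_assoc, sub_comp, X_comp]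
      rw [← mul_assoc, hCl]
      simp
    · intro f
      simp only [Tlam_app, mul_comp, C_comp, comp_assoc, add_comp, X_comp]
      rw [← mul_assoc, hCl']
      simp
  · apply LinearMap.ext
    intro f
    simp only [LinearMap.sub_apply, LinearMap.comp_apply, Tlam_app, Pmul,
      LinearMap.mulLeft_apply, mul_comp, X_comp, C_1]
    ring
  · intro W hT _ hP
    by_cases hW : W = ⊥
    · exact Or.inl hW
    right
    have hshift : ∀ f ∈ W, f.comp (X - C 1) ∈ W := by
      intro f hf
      have := W.smul_mem l⁻¹ (hT f hf)
      rwa [Tlam_app, smul_eq_C_mul, ← mul_assoc, hCl, one_mul] at this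
    have key : ∀ n : ℕ, ∀ f ∈ W, f ≠ 0 → f.natDegree = n → (1 : ℂ[X]) ∈ W := by
      intro n
      induction n using Nat.strong_induction_on with
      | _ n ih =>
        intro f hf hf0 hn
        by_cases h : f.comp (X - C 1) = f
        · have hc := const_of_periodic f h
          have h0 : f.eval 0 ≠ 0 := by
            intro h0
            rw [h0, C_0] at hc
            exact hf0 hc
          have := W.smul_mem (f.eval 0)⁻¹ hf
          rw [smul_eq_C_mul] at this
          nth_rewrite 2 [hc] at this
          rwa [← C_mul, inv_mul_cancel₀ h0, C_1] at this
        · have hd0 : f - f.comp (X - C 1) ≠ 0 := fun h' => h (sub_eq_zero.mp h').symm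
          have hnd : (f.comp (X - C 1)).natDegree = f.natDegree := by
            rw [natDegree_comp, natDegree_X_sub_C, mul_one]
          have hlc : (f.comp (X - C 1)).leadingCoeff = f.leadingCoeff := by
            rw [leadingCoeff_comp (by rw [natDegree_X_sub_C]; exact one_ne_zero),
              leadingCoeff_X_sub_C, one_pow, mul_one]
          have hg0 : f.comp (X - C 1) ≠ 0 := by
            rw [← leadingCoeff_ne_zero, hlc, leadingCoeff_ne_zero]
            exact hf0
          have hdeg : f.degree = (f.comp (X - C 1)).degree := by
            rw [degree_eq_natDegree hf0, degree_eq_natDegree hg0, hnd]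
          have hlt := degree_sub_lt hdeg hf0 hlc.symm
          refine ih _ ?_ _ (W.sub_mem hf (hshift f hf)) hd0 rfl
          rw [← hn]
          exact natDegree_lt_natDegree hd0 hlt
    obtain ⟨f, hf, hf0⟩ := W.ne_bot_iff.mp hW
    have h1 := key _ f hf hf0 rfl
    have hX : ∀ n : ℕ, (X ^ n : ℂ[X]) ∈ W := by
      intro n
      induction n with
      | zero => simpa using h1
      | succ k ih =>
        have := hP _ ih
        rwa [Pmul, LinearMap.mulLeft_apply, ← pow_succ'] at this
    rw [eq_top_iff]
    intro g _
    rw [g.as_sum_range_C_mul_X_pow]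
    refine W.sum_mem fun i _ => ?_
    rw [← smul_eq_C_mul]
    exact W.smul_mem _ (hX i)
end

section
/- Let λ, μ ∈ ℂ be nonzero. If there exists a linear bijection φ : ℂ[x] → ℂ[x] satisfying φ∘T_λ = T_μ∘φ and φ∘P = P∘φ, where (T_ν f)(x) = ν·f(x−1) and (P f)(x) = x·f(x), then λ = μ. In other words, the 𝒦-modules Ω(λ) for distinct nonzero λ are pairwise non-isomorphic. -/
open Polynomial

/-- if the `𝒦`-modules `Ω(λ)` and `Ω(μ)` (`λ, μ ≠ 0`) are
isomorphic — i.e. some linear bijection of `ℂ[x]` intertwines `T_λ` with `T_μ`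
and commutes with multiplication by `x` — then `λ = μ`. -/
theorem stmt12 (l m : ℂ) (hl : l ≠ 0) (hm : m ≠ 0)
    (φ : Polynomial ℂ ≃ₗ[ℂ] Polynomial ℂ)
    (hT : ∀ f, φ (Tlam l f) = Tlam m (φ f))
    (hP : ∀ f, φ (Pmul f) = Pmul (φ f)) :
    l = m := by
  have h := hT 1
  have hg : φ 1 ≠ 0 := by simp
  have h1 : ∀ (c : ℂ) (f : Polynomial ℂ), Tlam c f = c • f.comp (X - C 1) := by
    intro c f
    simp only [Tlam, LinearMap.smul_apply, AlgHom.toLinearMap_apply]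
    rfl
  rw [h1, h1, one_comp, map_smul] at h
  have h2 := congrArg leadingCoeff h
  rw [smul_eq_C_mul, smul_eq_C_mul, leadingCoeff_mul, leadingCoeff_mul, leadingCoeff_C,
    leadingCoeff_C, leadingCoeff_comp (by rw [natDegree_X_sub_C]; exact one_ne_zero),
    leadingCoeff_X_sub_C, one_pow, mul_one] at h2
  exact mul_right_cancel₀ (leadingCoeff_ne_zero.mpr hg) h2
end

section
/- Fix λ ∈ ℂ with λ ≠ 0 and b ∈ ℂ. On the polynomial space ℂ[x] define for each n ∈ ℤ the linear operator D_n by (D_n f)(x) = λ^n·(x + n(b−1))·f(x−n). Then the only subspaces of ℂ[x] invariant under all D_n (n ∈ ℤ) are 0 and ℂ[x] if and only if b ≠ 1. That is, the Virasoro module Ω(λ, b) is irreducible exactly when b ≠ 1. -/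
open Polynomial

/-- The action of the Virasoro generator `d_n` on `Ω(λ, b) = ℂ[x]`:
`(D_n f)(x) = λⁿ·(x + n(b−1))·f(x−n)`. -/
noncomputable def OmegaD (l b : ℂ) (n : ℤ) : Polynomial ℂ →ₗ[ℂ] Polynomial ℂ :=
  l ^ n • ((LinearMap.mulLeft ℂ (Polynomial.X + Polynomial.C ((n : ℂ) * (b - 1)))) ∘ₗ
    (Polynomial.aeval (Polynomial.X - Polynomial.C (n : ℂ)) :
      Polynomial ℂ →ₐ[ℂ] Polynomial ℂ).toLinearMap)

theorem OmegaD_apply (l b : ℂ) (n : ℤ) (f : Polynomial ℂ) :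
    OmegaD l b n f = l ^ n • ((X + C ((n : ℂ) * (b - 1))) * f.comp (X - C (n : ℂ))) := rfl

/-- for `λ ≠ 0`, the Virasoro module `Ω(λ, b)` is irreducible
(the only subspaces of `ℂ[x]` invariant under all `D_n` are `0` and `ℂ[x]`)
iff `b ≠ 1`. -/
theorem stmt14 (l : ℂ) (hl : l ≠ 0) (b : ℂ) :
    (∀ W : Submodule ℂ (Polynomial ℂ),
        (∀ (n : ℤ), ∀ f ∈ W, OmegaD l b n f ∈ W) → W = ⊥ ∨ W = ⊤)
    ↔ b ≠ 1 := by
  constructor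
  · intro h hb
    subst hb
    have hinv : ∀ (n : ℤ), ∀ f ∈ (Ideal.span {(X : Polynomial ℂ)}).restrictScalars ℂ,
        OmegaD l 1 n f ∈ (Ideal.span {(X : Polynomial ℂ)}).restrictScalars ℂ := by
      intro n f _
      rw [OmegaD_apply]
      apply Submodule.smul_mem
      simp only [Submodule.restrictScalars_mem, Ideal.mem_span_singleton]
      simp
    rcases h _ hinv with h | h
    · have : (X : Polynomial ℂ) ∈ (Ideal.span {(X : Polynomial ℂ)}).restrictScalars ℂ := by
        simp [Ideal.mem_span_singleton]
      rw [h] at this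
      simp at this
    · have : (1 : Polynomial ℂ) ∈ (Ideal.span {(X : Polynomial ℂ)}).restrictScalars ℂ := by
        rw [h]; trivial
      simp only [Submodule.restrictScalars_mem, Ideal.mem_span_singleton] at this
      rw [X_dvd_iff] at this
      simp at this
  · intro hb W hW
    have hmul : ∀ p f : Polynomial ℂ, f ∈ W → p * f ∈ W := by
      intro p
      induction p using Polynomial.induction_on' with
      | add p q hp hq =>
        intro f hf
        rw [add_mul]
        exact W.add_mem (hp f hf) (hq f hf)
      | monomial n a =>
        intro f hf
        rw [← C_mul_X_pow_eq_monomial, mul_assoc, ← smul_eq_C_mul]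
        apply W.smul_mem
        induction n with
        | zero => simpa using hf
        | succ k ih =>
          have := hW 0 _ ih
          rw [OmegaD_apply] at this
          simp only [zpow_zero, Int.cast_zero, zero_mul, map_zero, add_zero, sub_zero, comp_X,
            one_smul] at this
          rwa [pow_succ', mul_assoc]
    let I : Ideal (Polynomial ℂ) :=
      { carrier := W
        add_mem' := W.add_mem
        zero_mem' := W.zero_mem
        smul_mem' := fun p f hf => hmul p f hf }
    have hI : ∀ f, f ∈ I ↔ f ∈ W := fun f => Iff.rfl
    obtain ⟨g, hg⟩ := IsPrincipalIdealRing.principal I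
    have hI' : ∀ f, f ∈ W ↔ g ∣ f := by
      intro f
      rw [← hI, hg]
      exact Ideal.mem_span_singleton
    by_cases hg0 : g = 0
    · left
      rw [eq_bot_iff]
      intro f hf
      rw [hI', hg0, zero_dvd_iff] at hf
      simp [hf]
    right
    by_cases hu : IsUnit g
    · rw [eq_top_iff]
      intro f _
      rw [hI']
      exact hu.dvd
    exfalso
    have hd : g.degree ≠ 0 := fun h => hu (isUnit_iff_degree_eq_zero.2 h)
    obtain ⟨a, ha⟩ := IsAlgClosed.exists_root g hd
    have key : (C a + C (b - 1) * X) * g.comp (C a - X) = 0 := by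
      apply Polynomial.eq_zero_of_infinite_isRoot
      apply Set.Infinite.mono _ (Set.infinite_range_of_injective (Int.cast_injective (α := ℂ)))
      rintro _ ⟨n, rfl⟩
      have h1 := (hI' _).1 (hW n g ((hI' g).2 dvd_rfl))
      have h2 := ha.dvd h1
      rw [OmegaD_apply, IsRoot.def, eval_smul, smul_eq_mul] at h2
      have h3 := (mul_eq_zero.1 h2).resolve_left (zpow_ne_zero n hl)
      simp only [Set.mem_ofPred_eq, IsRoot.def]
      simp only [eval_mul, eval_add, eval_X, eval_C, eval_comp, eval_sub] at h3 ⊢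
      rw [← h3]; ring
    rcases mul_eq_zero.1 key with h | h
    · have := congrArg (fun p => coeff p 1) h
      simp [coeff_C] at this
      exact hb (sub_eq_zero.1 this)
    · apply hg0
      have := congrArg (fun p => p.comp (C a - X)) h
      simpa [comp_assoc] using this
end

section
/- Fix λ ∈ ℂ with λ ≠ 0. On ℂ[x] define for each n ∈ ℤ the operators D_n^{(1)} by (D_n^{(1)} f)(x) = λ^n·x·f(x−n) (the action of d_n on Ω(λ,1)) and D_n^{(0)} by (D_n^{(0)} f)(x) = λ^n·(x−n)·f(x−n) (the action of d_n on Ω(λ,0)). Then the subspace x·ℂ[x] of polynomials with zero constant term is invariant under all D_n^{(1)}, and the linear bijection ψ : ℂ[x] → x·ℂ[x] defined by (ψ g)(x) = x·g(x) satisfies ψ(D_n^{(0)} g) = D_n^{(1)}(ψ g) for all n ∈ ℤ and g ∈ ℂ[x]. Hence Ω(λ,1) has the proper nonzero submodule x·ℂ[x], which is isomorphic to Ω(λ,0) as a module over the centerless Virasoro algebra. -/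
open Polynomial

/-- for `λ ≠ 0`, the subspace `x·ℂ[x]` is invariant under all
operators `D_n` of `Ω(λ,1)`; the map `ψ : g ↦ x·g` intertwines the action of
`Ω(λ,0)` with that of `Ω(λ,1)`; and `x·ℂ[x]` is a nonzero proper subspace.
Hence `Ω(λ,1)` has the proper nonzero submodule `x·ℂ[x] ≅ Ω(λ,0)`. -/
theorem stmt15 (l : ℂ) (hl : l ≠ 0) :
    (∀ (n : ℤ), ∀ f ∈ LinearMap.range (LinearMap.mulLeft ℂ (Polynomial.X : Polynomial ℂ)),
      OmegaD l 1 n f ∈ LinearMap.range (LinearMap.mulLeft ℂ (Polynomial.X : Polynomial ℂ)))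
    ∧ (∀ (n : ℤ) (g : Polynomial ℂ),
        Polynomial.X * OmegaD l 0 n g = OmegaD l 1 n (Polynomial.X * g))
    ∧ LinearMap.range (LinearMap.mulLeft ℂ (Polynomial.X : Polynomial ℂ)) ≠ ⊥
    ∧ LinearMap.range (LinearMap.mulLeft ℂ (Polynomial.X : Polynomial ℂ)) ≠ ⊤ := by
  have key : ∀ (n : ℤ) (g : Polynomial ℂ),
      Polynomial.X * OmegaD l 0 n g = OmegaD l 1 n (Polynomial.X * g) := by
    intro n g
    simp only [OmegaD, LinearMap.smul_apply, LinearMap.comp_apply, LinearMap.mulLeft_apply,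
      AlgHom.toLinearMap_apply, map_mul, Polynomial.aeval_X, mul_smul_comm]
    congr 1
    simp only [sub_self, zero_sub, mul_zero, map_zero, map_neg, map_one, mul_neg, mul_one]
    ring
  refine ⟨?_, key, ?_, ?_⟩
  · rintro n f ⟨g, rfl⟩
    exact ⟨OmegaD l 0 n g, by simpa using key n g⟩
  · intro h
    have h1 : (Polynomial.X : Polynomial ℂ) ∈
        LinearMap.range (LinearMap.mulLeft ℂ (Polynomial.X : Polynomial ℂ)) := ⟨1, by simp⟩
    rw [h, Submodule.mem_bot] at h1
    exact Polynomial.X_ne_zero h1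
  · intro h
    have h1 : (1 : Polynomial ℂ) ∈
        LinearMap.range (LinearMap.mulLeft ℂ (Polynomial.X : Polynomial ℂ)) := by
      rw [h]; trivial
    obtain ⟨g, hg⟩ := h1
    have h2 := congrArg (Polynomial.eval 0) hg
    simp at h2
end

section
/- Let f ∈ ℂ[x] be a nonconstant polynomial. On the polynomial space ℂ[x] define the linear maps P by (P g)(x) = x·g(x) and T by T(g) = f·g − g′ (where g′ is the derivative of g). Then M := P∘T − T∘P is the identity map, and the only subspaces of ℂ[x] invariant under both P and T are 0 and ℂ[x]. (This is the simplicity of the module ℂ[t][d/dt]/J, J the left ideal generated by f(d/dt) − t, which proves that f(d/dt) − t is irreducible in ℂ(t)[∂].) -/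
open Polynomial

/-- Lemma 16 of the paper: for a nonconstant `f ∈ ℂ[x]`, the maps
`P : g ↦ x·g` and `T : g ↦ f·g − g′` on `ℂ[x]` satisfy `P∘T − T∘P = id`, and
the only subspaces invariant under both `P` and `T` are `0` and `ℂ[x]`.
(This is the simplicity of `ℂ[t][d/dt]/J`, `J` the left ideal generated by
`f(d/dt) − t`, proving that `f(d/dt) − t` is irreducible in `ℂ(t)[∂]`.) -/
theorem stmt17 (f : Polynomial ℂ) (hf : f.natDegree ≠ 0) :
    (LinearMap.mulLeft ℂ (Polynomial.X : Polynomial ℂ)) ∘ₗ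
        (LinearMap.mulLeft ℂ f - Polynomial.derivative)
      - (LinearMap.mulLeft ℂ f - Polynomial.derivative) ∘ₗ
        (LinearMap.mulLeft ℂ (Polynomial.X : Polynomial ℂ))
      = LinearMap.id
    ∧ ∀ W : Submodule ℂ (Polynomial ℂ),
        (∀ g ∈ W, Polynomial.X * g ∈ W) →
        (∀ g ∈ W, f * g - Polynomial.derivative g ∈ W) →
        W = ⊥ ∨ W = ⊤ := by
  refine ⟨?_, ?_⟩
  · refine LinearMap.ext fun g => ?_
    simp only [LinearMap.sub_apply, LinearMap.comp_apply, LinearMap.mulLeft_apply,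
      LinearMap.id_apply, Polynomial.derivative_mul, Polynomial.derivative_X]
    ring
  · intro W hX hT
    have hmul : ∀ p g : Polynomial ℂ, g ∈ W → p * g ∈ W := by
      intro p
      induction p using Polynomial.induction_on' with
      | add p q hp hq =>
        intro g hg
        rw [add_mul]
        exact W.add_mem (hp g hg) (hq g hg)
      | monomial n a =>
        intro g hg
        rw [← Polynomial.C_mul_X_pow_eq_monomial, mul_assoc, ← Polynomial.smul_eq_C_mul]
        apply W.smul_mem
        induction n with
        | zero => simpa using hg
        | succ n ih =>
          rw [pow_succ', mul_assoc]
          exact hX _ ih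
    have hD : ∀ g ∈ W, Polynomial.derivative g ∈ W := by
      intro g hg
      have h := W.sub_mem (hmul f g hg) (hT g hg)
      simpa using h
    have key : ∀ n : ℕ, ∀ g ∈ W, g ≠ 0 → g.natDegree = n → (1 : Polynomial ℂ) ∈ W := by
      intro n
      induction n using Nat.strong_induction_on with
      | _ n ih =>
        intro g hg h0 hn
        by_cases hd : g.natDegree = 0
        · rw [Polynomial.eq_C_of_natDegree_eq_zero hd] at hg h0
          have hc : g.coeff 0 ≠ 0 := fun h => h0 (by rw [h, Polynomial.C_0])
          have h := hmul (Polynomial.C (g.coeff 0)⁻¹) _ hg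
          rwa [← Polynomial.C_mul, inv_mul_cancel₀ hc, Polynomial.C_1] at h
        · refine ih _ ?_ _ (hD g hg) ?_ rfl
          · rw [← hn]
            exact Polynomial.natDegree_derivative_lt hd
          · intro h
            exact hd (Polynomial.natDegree_eq_zero_of_derivative_eq_zero h)
    by_cases hW : W = ⊥
    · exact Or.inl hW
    · right
      obtain ⟨g, hg, h0⟩ := W.ne_bot_iff.mp hW
      have h1 := key _ g hg h0 rfl
      refine eq_top_iff.mpr fun p _ => ?_
      simpa using hmul p 1 h1
end

section
/- Let V be a complex vector space with a bijective linear map T : V → V and a linear map P : V → V satisfying P∘T − T∘P = T. Assume V is ℂ[t]-torsion-free: for every nonzero v ∈ V and every nonzero polynomial q ∈ ℂ[X], q(T)·v ≠ 0. Fix b ∈ ℂ and set D_n := T^n∘P + n·b·T^n. Let z ∈ ℂ with z ≠ 0 and m₂, m₃, m₄ ∈ ℂ with z·m₃ ≠ m₄. If u ∈ V satisfies (D₃ − z·D₂)u = (m₃ − z·m₂)·u and (D₄ − z·D₃)u = (m₄ − z·m₃)·u, then u = 0. (Hence the twisted Virasoro module A_b contains no Whittaker-type vector of the modules Ind_{θ,z}(ℂ_𝐦)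 of Mazorchuk–Weisner, so A_b is not isomorphic to any such module.) -/
/-- if the `𝒦`-module `(V, T, P)` is `ℂ[t]`-torsion-free,
`z ≠ 0` and `z·m₃ ≠ m₄`, then the twisted Virasoro module `A_b` contains no
nonzero vector `u` with `(d₃ − z·d₂)u = (m₃ − z·m₂)u` and
`(d₄ − z·d₃)u = (m₄ − z·m₃)u`; hence `A_b` is not isomorphic to any
Mazorchuk–Weisner module `Ind_{θ,z}(ℂ_𝐦)`. -/
theorem stmt19 (V : Type*) [AddCommGroup V] [Module ℂ V]
    (T : V ≃ₗ[ℂ] V) (P : V →ₗ[ℂ] V)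
    (hcomm : P ∘ₗ (T : V →ₗ[ℂ] V) - (T : V →ₗ[ℂ] V) ∘ₗ P = (T : V →ₗ[ℂ] V))
    (htf : ∀ v : V, v ≠ 0 → ∀ q : Polynomial ℂ, q ≠ 0 →
      (Polynomial.aeval ((T : V →ₗ[ℂ] V) : Module.End ℂ V) q) v ≠ 0)
    (b z m₂ m₃ m₄ : ℂ) (hz : z ≠ 0) (hm : z * m₃ ≠ m₄)
    (u : V)
    (h1 : Dop T P b 3 u - z • Dop T P b 2 u = (m₃ - z * m₂) • u)
    (h2 : Dop T P b 4 u - z • Dop T P b 3 u = (m₄ - z * m₃) • u) :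
    u = 0 := by
  by_contra hu
  have e : ∀ (n : ℕ) (v : V), (T ^ (n : ℤ) : V ≃ₗ[ℂ] V) v = ((T : V →ₗ[ℂ] V) ^ n) v := by
    intro n
    induction n with
    | zero => intro v; simp
    | succ k ih =>
      intro v
      have h := ih (T v)
      rw [zpow_natCast] at h ⊢
      rw [pow_succ, pow_succ]
      exact h
  have e2 := e 2
  have e3 := e 3
  have e4 := e 4
  push_cast at e2 e3 e4
  simp only [Dop, LinearMap.add_apply, LinearMap.comp_apply, LinearMap.smul_apply,
    LinearEquiv.coe_coe, e2, e3, e4] at h1 h2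
  have h1' := congrArg (T : V →ₗ[ℂ] V) h1
  simp only [map_sub, map_add, map_smul] at h1'
  have s3 : ∀ v, (T : V →ₗ[ℂ] V) (((T : V →ₗ[ℂ] V) ^ 3) v) = ((T : V →ₗ[ℂ] V) ^ 4) v := by
    intro v; rw [pow_succ' _ 3]; rfl
  have s2 : ∀ v, (T : V →ₗ[ℂ] V) (((T : V →ₗ[ℂ] V) ^ 2) v) = ((T : V →ₗ[ℂ] V) ^ 3) v := by
    intro v; rw [pow_succ' _ 2]; rfl
  rw [s3, s3, s2, s2] at h1'
  refine htf u hu (Polynomial.C b * Polynomial.X ^ 4 - Polynomial.C (b * z) * Polynomial.X ^ 3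
    + Polynomial.C (m₃ - z * m₂) * Polynomial.X - Polynomial.C (m₄ - z * m₃)) ?_ ?_
  · intro h
    have := congrArg (Polynomial.eval 0) h
    simp at this
    exact hm (by linear_combination this)
  · simp only [map_add, map_sub, map_mul, map_neg, map_pow, Polynomial.aeval_X,
      Polynomial.aeval_C, Module.algebraMap_end_eq_smul_id, LinearMap.add_apply,
      LinearMap.sub_apply, LinearMap.neg_apply, Module.End.mul_apply, LinearMap.smul_apply,
      LinearMap.id_apply]
    push_cast at h1' h2
    linear_combination (norm := module) h2 - h1'
end
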